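/- arXiv:2509.26445 — 2 statements merged into one kernel-verified Lean document; each statement's English description precedes it below -/
import Mathlib

section
/- For every set F of pairwise coherent routes of G(H), there exists a unique maximal clique Cmax(F) containing F with the following property: for every maximal clique C containing F, there is a finite sequence of maximal cliques C = C_0, C_1, …, C_k = Cmax(F) such that each C_{l+1} is obtained from C_l by a single counterclockwise rotation and F ⊆ C_l for every l. -/
open Finset Filter Pointwise

/-- Neighbors in the right shore `T` of a left vertex `i`. -/
def Nbr (E : Finset (ℕ × ℕ)) (i : ℕ) : Finset ℕ :=
  (E.filter (fun p => p.1 = i)).image Prod.snd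

/-- Neighbors in the left shore `S` of a right vertex `j`. -/
def Nbr' (E : Finset (ℕ × ℕ)) (j : ℕ) : Finset ℕ :=
  (E.filter (fun p => p.2 = j)).image Prod.fst

/-- A route of `G(H)`: a triple `(a, (i,j), c)` with `a, c ∈ {1,2}`, `(i,j) ∈ E`,
representing the path `α_{a,i} β_{i,j} γ_{j,c}`. -/
abbrev Route : Type := ℕ × (ℕ × ℕ) × ℕ

def IsRoute (E : Finset (ℕ × ℕ)) (r : Route) : Prop :=
  (r.1 = 1 ∨ r.1 = 2) ∧ r.2.1 ∈ E ∧ (r.2.2 = 1 ∨ r.2.2 = 2)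

/-- Two routes are in conflict with respect to the canonical bipartite framing. -/
def Conflict (r r' : Route) : Prop :=
  (r.2.1 = r'.2.1 ∧
    ((r.1 = 1 ∧ r.2.2 = 2 ∧ r'.1 = 2 ∧ r'.2.2 = 1) ∨
     (r.1 = 2 ∧ r.2.2 = 1 ∧ r'.1 = 1 ∧ r'.2.2 = 2))) ∨
  (r.2.1.1 = r'.2.1.1 ∧ r.2.1.2 ≠ r'.2.1.2 ∧
    ((r.2.1.2 < r'.2.1.2 ∧ r'.1 = 1 ∧ r.1 = 2) ∨
     (r'.2.1.2 < r.2.1.2 ∧ r.1 = 1 ∧ r'.1 = 2))) ∨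
  (r.2.1.2 = r'.2.1.2 ∧ r.2.1.1 ≠ r'.2.1.1 ∧
    ((r.2.1.1 < r'.2.1.1 ∧ r.2.2 = 2 ∧ r'.2.2 = 1) ∨
     (r'.2.1.1 < r.2.1.1 ∧ r'.2.2 = 2 ∧ r.2.2 = 1)))

/-- A clique: a set of pairwise coherent routes. -/
def IsClique (E : Finset (ℕ × ℕ)) (C : Set Route) : Prop :=
  (∀ r ∈ C, IsRoute E r) ∧ ∀ r ∈ C, ∀ r' ∈ C, r ≠ r' → ¬ Conflict r r'

/-- A maximal clique of routes. -/
def IsMaxClique (E : Finset (ℕ × ℕ)) (C : Set Route) : Prop :=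
  IsClique E C ∧ ∀ C' : Set Route, IsClique E C' → C ⊆ C' → C' = C

/-- `r` is clockwise from `r'` with respect to the canonical bipartite framing. -/
def Clockwise (r r' : Route) : Prop :=
  (r.2.1 = r'.2.1 ∧ r.1 = 1 ∧ r.2.2 = 2 ∧ r'.1 = 2 ∧ r'.2.2 = 1) ∨
  (r.2.1.1 = r'.2.1.1 ∧ r'.2.1.2 < r.2.1.2 ∧ r.1 = 1 ∧ r'.1 = 2) ∨
  (r.2.1.2 = r'.2.1.2 ∧ r.2.1.1 < r'.2.1.1 ∧ r.2.2 = 2 ∧ r'.2.2 = 1)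

/-- `C'` is obtained from `C` by a single counterclockwise rotation. -/
def CCWStep (C C' : Set Route) : Prop :=
  ∃ r ∈ C, ∃ r' ∈ C', Clockwise r r' ∧ C \ {r} = C' \ {r'}

/-- The routes allowed by thresholds `t` at the left vertices, `u` at the right vertices, and a
choice `ε` between `(1, e, 2)` and `(2, e, 1)` at the edges `e` that are thresholds at both ends. -/
def thresholdClique (E : Finset (ℕ × ℕ)) (t u : ℕ → ℕ) (ε : ℕ × ℕ → Prop) : Set Route :=
  {r | IsRoute E r ∧ (r.1 = 1 → r.2.1.2 ≤ t r.2.1.1) ∧ (r.1 = 2 → t r.2.1.1 ≤ r.2.1.2) ∧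
    (r.2.2 = 1 → r.2.1.1 ≤ u r.2.1.2) ∧ (r.2.2 = 2 → u r.2.1.2 ≤ r.2.1.1) ∧
    (t r.2.1.1 = r.2.1.2 → u r.2.1.2 = r.2.1.1 →
      (ε r.2.1 → ¬ (r.1 = 1 ∧ r.2.2 = 2)) ∧ (¬ ε r.2.1 → ¬ (r.1 = 2 ∧ r.2.2 = 1)))}

/-- The thresholds select an edge at every non-isolated vertex. -/
def ValidThresholds (E : Finset (ℕ × ℕ)) (t u : ℕ → ℕ) : Prop :=
  ∀ i j, (i, j) ∈ E → (i, t i) ∈ E ∧ (u j, j) ∈ E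

theorem mem_thresholdClique {E : Finset (ℕ × ℕ)} {t u : ℕ → ℕ} {ε : ℕ × ℕ → Prop} {a i j c : ℕ} :
    ((a, (i, j), c) : Route) ∈ thresholdClique E t u ε ↔
      ((a = 1 ∨ a = 2) ∧ (i, j) ∈ E ∧ (c = 1 ∨ c = 2)) ∧ (a = 1 → j ≤ t i) ∧ (a = 2 → t i ≤ j) ∧
      (c = 1 → i ≤ u j) ∧ (c = 2 → u j ≤ i) ∧
      (t i = j → u j = i → (ε (i, j) → ¬ (a = 1 ∧ c = 2)) ∧ (¬ ε (i, j) → ¬ (a = 2 ∧ c = 1))) :=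
  Iff.rfl

theorem isClique_thresholdClique (E : Finset (ℕ × ℕ)) (t u : ℕ → ℕ) (ε : ℕ × ℕ → Prop) :
    IsClique E (thresholdClique E t u ε) := by
  refine ⟨fun r hr => hr.1, ?_⟩
  rintro ⟨a, ⟨i, j⟩, c⟩ hr ⟨a', ⟨i', j'⟩, c'⟩ hr' - h
  rw [mem_thresholdClique] at hr hr'
  simp only [Conflict, Prod.mk.injEq] at h
  grind

theorem exists_mem_thresholdClique_left {E : Finset (ℕ × ℕ)} {t u : ℕ → ℕ} {ε : ℕ × ℕ → Prop}
    (hv : ValidThresholds E t u) {a i j : ℕ} (hij : (i, j) ∈ E) (ha : a = 1 ∨ a = 2) :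
    ∃ c, ((a, (i, t i), c) : Route) ∈ thresholdClique E t u ε := by
  have h := (hv i j hij).1
  simp only [mem_thresholdClique]
  rcases lt_trichotomy i (u (t i)) with h1 | h1 | h1
  · exact ⟨1, by grind⟩
  · exact ⟨a, by grind⟩
  · exact ⟨2, by grind⟩

theorem exists_mem_thresholdClique_right {E : Finset (ℕ × ℕ)} {t u : ℕ → ℕ} {ε : ℕ × ℕ → Prop}
    (hv : ValidThresholds E t u) {i j c : ℕ} (hij : (i, j) ∈ E) (hc : c = 1 ∨ c = 2) :
    ∃ a, ((a, (u j, j), c) : Route) ∈ thresholdClique E t u ε := by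
  have h := (hv i j hij).2
  simp only [mem_thresholdClique]
  rcases lt_trichotomy j (t (u j)) with h1 | h1 | h1
  · exact ⟨1, by grind⟩
  · exact ⟨c, by grind⟩
  · exact ⟨2, by grind⟩

theorem isMaxClique_thresholdClique {E : Finset (ℕ × ℕ)} {t u : ℕ → ℕ} (ε : ℕ × ℕ → Prop)
    (hv : ValidThresholds E t u) : IsMaxClique E (thresholdClique E t u ε) := by
  refine ⟨isClique_thresholdClique E t u ε, fun C hC hsub => (hsub.antisymm ?_).symm⟩
  rintro ⟨a, ⟨i, j⟩, c⟩ hr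
  have hroute := hC.1 _ hr
  simp only [IsRoute] at hroute
  obtain ⟨ha, hij, hc⟩ := hroute
  have coh : ∀ r' ∈ thresholdClique E t u ε, ((a, (i, j), c) : Route) ≠ r' →
      ¬ Conflict (a, (i, j), c) r' := fun r' h' => hC.2 _ hr _ (hsub h')
  obtain ⟨c₁, h1⟩ := exists_mem_thresholdClique_left (ε := ε) hv hij (Or.inl rfl : 1 = 1 ∨ 1 = 2)
  obtain ⟨c₂, h2⟩ := exists_mem_thresholdClique_left (ε := ε) hv hij (Or.inr rfl : 2 = 1 ∨ 2 = 2)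
  obtain ⟨a₁, h3⟩ := exists_mem_thresholdClique_right (ε := ε) hv hij (Or.inl rfl : 1 = 1 ∨ 1 = 2)
  obtain ⟨a₂, h4⟩ := exists_mem_thresholdClique_right (ε := ε) hv hij (Or.inr rfl : 2 = 1 ∨ 2 = 2)
  have k1 := coh _ h1
  have k2 := coh _ h2
  have k3 := coh _ h3
  have k4 := coh _ h4
  have k5 := coh (1, (i, j), 2)
  have k6 := coh (2, (i, j), 1)
  simp only [mem_thresholdClique, Conflict, ne_eq, Prod.mk.injEq] at k1 k2 k3 k4 k5 k6
  clear h1 h2 h3 h4 coh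
  rw [mem_thresholdClique]
  refine ⟨⟨ha, hij, hc⟩, ?_, ?_, ?_, ?_, ?_⟩
  · clear k1 k3 k4 k5 k6; grind
  · clear k2 k3 k4 k5 k6; grind
  · clear k1 k2 k3 k5 k6; grind
  · clear k1 k2 k4 k5 k6; grind
  · clear k1 k2 k3 k4; grind

theorem IsClique.subset_thresholdClique {E : Finset (ℕ × ℕ)} {F : Set Route} (hF : IsClique E F) :
    ∃ t u ε, ValidThresholds E t u ∧ F ⊆ thresholdClique E t u ε := by
  classical
  have key : ∀ i, ∃ k, ∀ j, (i, j) ∈ E → (i, k) ∈ E ∧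
      ∀ f ∈ F, f.2.1.1 = i → (f.1 = 1 → f.2.1.2 ≤ k) ∧ (f.1 = 2 → k ≤ f.2.1.2) := by
    intro i
    by_cases hi : ∃ j, (i, j) ∈ E
    · have hne : ∃ k, (i, k) ∈ E ∧ ∀ f ∈ F, f.2.1.1 = i → f.1 = 1 → f.2.1.2 ≤ k := by
        obtain ⟨j, hj⟩ := hi
        obtain ⟨p, hp, hmax⟩ := (E.filter (fun p => p.1 = i)).exists_max_image Prod.snd
          ⟨(i, j), by simp [hj]⟩
        obtain ⟨hpE, rfl⟩ := Finset.mem_filter.1 hp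
        exact ⟨p.2, hpE, fun f hf h _ =>
          hmax f.2.1 (Finset.mem_filter.2 ⟨(hF.1 f hf).2.1, h⟩)⟩
      refine ⟨Nat.find hne, fun j _ => ⟨(Nat.find_spec hne).1, fun f hf h =>
        ⟨(Nat.find_spec hne).2 f hf h, fun h2 => Nat.find_min' hne ⟨?_, fun g hg hgi hg1 => ?_⟩⟩⟩⟩
      · have := (hF.1 f hf).2.1
        rwa [← h]
      · by_contra hlt
        refine hF.2 f hf g hg (by rintro rfl; omega) (Or.inr (Or.inl ⟨by omega, by omega, ?_⟩))
        omega
    · exact ⟨0, fun j hj => (hi ⟨j, hj⟩).elim⟩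
  have key' : ∀ j, ∃ k, ∀ i, (i, j) ∈ E → (k, j) ∈ E ∧
      ∀ f ∈ F, f.2.1.2 = j → (f.2.2 = 1 → f.2.1.1 ≤ k) ∧ (f.2.2 = 2 → k ≤ f.2.1.1) := by
    intro j
    by_cases hj : ∃ i, (i, j) ∈ E
    · have hne : ∃ k, (k, j) ∈ E ∧ ∀ f ∈ F, f.2.1.2 = j → f.2.2 = 1 → f.2.1.1 ≤ k := by
        obtain ⟨i, hi⟩ := hj
        obtain ⟨p, hp, hmax⟩ := (E.filter (fun p => p.2 = j)).exists_max_image Prod.fst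
          ⟨(i, j), by simp [hi]⟩
        obtain ⟨hpE, rfl⟩ := Finset.mem_filter.1 hp
        exact ⟨p.1, hpE, fun f hf h _ =>
          hmax f.2.1 (Finset.mem_filter.2 ⟨(hF.1 f hf).2.1, h⟩)⟩
      refine ⟨Nat.find hne, fun i _ => ⟨(Nat.find_spec hne).1, fun f hf h =>
        ⟨(Nat.find_spec hne).2 f hf h, fun h2 => Nat.find_min' hne ⟨?_, fun g hg hgi hg1 => ?_⟩⟩⟩⟩
      · have := (hF.1 f hf).2.1
        rwa [← h]
      · by_contra hlt
        refine hF.2 f hf g hg (by rintro rfl; omega) (Or.inr (Or.inr ⟨by omega, by omega, ?_⟩))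
        omega
    · exact ⟨0, fun i hi => (hj ⟨i, hi⟩).elim⟩
  choose t ht using key
  choose u hu using key'
  refine ⟨t, u, fun e => ((1, e, 2) : Route) ∉ F,
    fun i j h => ⟨(ht i j h).1, (hu j i h).1⟩, ?_⟩
  rintro ⟨a, ⟨i, j⟩, c⟩ hf
  have hr := hF.1 _ hf
  have h1 := (ht i j hr.2.1).2 _ hf rfl
  have h2 := (hu j i hr.2.1).2 _ hf rfl
  refine ⟨hr, h1.1, h1.2, h2.1, h2.2, fun _ _ => ⟨?_, ?_⟩⟩
  · rintro h ⟨rfl, rfl⟩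
    exact h hf
  · rintro h ⟨rfl, rfl⟩
    rw [not_not] at h
    exact hF.2 _ h _ hf (by simp) (by simp [Conflict])

theorem IsMaxClique.eq_thresholdClique {E : Finset (ℕ × ℕ)} {C : Set Route}
    (hC : IsMaxClique E C) :
    ∃ t u ε, ValidThresholds E t u ∧ C = thresholdClique E t u ε := by
  obtain ⟨t, u, ε, hv, h⟩ := hC.1.subset_thresholdClique
  exact ⟨t, u, ε, hv, (hC.2 _ (isClique_thresholdClique E t u ε) h).symm⟩

theorem thresholdClique_flip {E : Finset (ℕ × ℕ)} {t u : ℕ → ℕ} {ε : ℕ × ℕ → Prop} {i j : ℕ}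
    (hij : (i, j) ∈ E) (ht : t i = j) (hu : u j = i) (hε : ¬ ε (i, j)) :
    ((1, (i, j), 2) : Route) ∈ thresholdClique E t u ε ∧
    ((2, (i, j), 1) : Route) ∈ thresholdClique E t u (Function.update ε (i, j) True) ∧
    thresholdClique E t u ε \ {(1, (i, j), 2)} =
      thresholdClique E t u (Function.update ε (i, j) True) \ {(2, (i, j), 1)} := by
  refine ⟨by grind [mem_thresholdClique], by grind [mem_thresholdClique], ?_⟩
  ext ⟨a, ⟨x, y⟩, c⟩
  simp only [Set.mem_sdiff, Set.mem_singleton_iff, mem_thresholdClique, Prod.mk.injEq,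
    Function.update_apply]
  grind

theorem thresholdClique_lower_left {E : Finset (ℕ × ℕ)} {t u : ℕ → ℕ} {ε : ℕ × ℕ → Prop}
    {i j : ℕ} (hi : (i, t i) ∈ E) (hij : (i, j) ∈ E) (hlt : j < t i)
    (hpred : ∀ y, (i, y) ∈ E → y < t i → y ≤ j) (hε : u (t i) = i → ε (i, t i)) :
    ((1, (i, t i), if i ≤ u (t i) then 1 else 2) : Route) ∈ thresholdClique E t u ε ∧
    ((2, (i, j), if i < u j then 1 else 2) : Route) ∈
      thresholdClique E (Function.update t i j) u (Function.update ε (i, j) False) ∧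
    thresholdClique E t u ε \ {(1, (i, t i), if i ≤ u (t i) then 1 else 2)} =
      thresholdClique E (Function.update t i j) u (Function.update ε (i, j) False) \
        {(2, (i, j), if i < u j then 1 else 2)} := by
  refine ⟨by grind [mem_thresholdClique], by grind [mem_thresholdClique], ?_⟩
  ext ⟨a, ⟨x, y⟩, c⟩
  simp only [Set.mem_sdiff, Set.mem_singleton_iff, mem_thresholdClique, Prod.mk.injEq,
    Function.update_apply]
  by_cases hx : x = i
  · subst hx
    have := hpred y
    grind
  · grind

theorem thresholdClique_raise_right {E : Finset (ℕ × ℕ)} {t u : ℕ → ℕ} {ε : ℕ × ℕ → Prop}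
    {i j : ℕ} (hj : (u j, j) ∈ E) (hij : (i, j) ∈ E) (hlt : u j < i)
    (hsucc : ∀ x, (x, j) ∈ E → u j < x → i ≤ x) (hε : t (u j) = j → ε (u j, j)) :
    ((if j < t (u j) then 1 else 2, (u j, j), 2) : Route) ∈ thresholdClique E t u ε ∧
    ((if j ≤ t i then 1 else 2, (i, j), 1) : Route) ∈
      thresholdClique E t (Function.update u j i) (Function.update ε (i, j) False) ∧
    thresholdClique E t u ε \ {(if j < t (u j) then 1 else 2, (u j, j), 2)} =
      thresholdClique E t (Function.update u j i) (Function.update ε (i, j) False) \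
        {(if j ≤ t i then 1 else 2, (i, j), 1)} := by
  refine ⟨by grind [mem_thresholdClique], by grind [mem_thresholdClique], ?_⟩
  ext ⟨a, ⟨x, y⟩, c⟩
  simp only [Set.mem_sdiff, Set.mem_singleton_iff, mem_thresholdClique, Prod.mk.injEq,
    Function.update_apply]
  by_cases hy : y = j
  · subst hy
    have := hsucc x
    grind
  · grind

theorem exists_ccwStep_of_exchange {E : Finset (ℕ × ℕ)} {F C C' : Set Route} {r r' : Route}
    (hC' : IsMaxClique E C') (hFC : F ⊆ C) (hrF : r ∉ F) (hcw : Clockwise r r')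
    (h : r ∈ C ∧ r' ∈ C' ∧ C \ {r} = C' \ {r'}) :
    ∃ C', IsMaxClique E C' ∧ F ⊆ C' ∧ CCWStep C C' := by
  refine ⟨C', hC', fun f hf => ?_, r, h.1, r', h.2.1, hcw, h.2.2⟩
  have hf' : f ∈ C \ {r} := ⟨hFC hf, by rintro rfl; exact hrF hf⟩
  rw [h.2.2] at hf'
  exact hf'.1

theorem exists_ccwStep_of_left {E : Finset (ℕ × ℕ)} {F : Set Route} {t u : ℕ → ℕ}
    {ε : ℕ × ℕ → Prop} (hv : ValidThresholds E t u) (hF : F ⊆ thresholdClique E t u ε) {i j : ℕ}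
    (hij : (i, j) ∈ E) (hlt : j < t i) (hnot : ∀ c, ((1, (i, t i), c) : Route) ∉ F) :
    ∃ C', IsMaxClique E C' ∧ F ⊆ C' ∧ CCWStep (thresholdClique E t u ε) C' := by
  classical
  have hi := (hv i j hij).1
  by_cases hε : u (t i) = i → ε (i, t i)
  · obtain ⟨p, hp, hmax⟩ := (E.filter (fun p => p.1 = i ∧ p.2 < t i)).exists_max_image Prod.snd
      ⟨(i, j), by simp [hij, hlt]⟩
    obtain ⟨i', k⟩ := p
    obtain ⟨hpE, rfl, hk⟩ := Finset.mem_filter.1 hp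
    dsimp only at *
    refine exists_ccwStep_of_exchange (isMaxClique_thresholdClique _ ?_) hF (hnot _) ?_
      (thresholdClique_lower_left hi hpE hk
        (fun y hy hy' => hmax (i', y) (by simp [hy, hy'])) hε)
    · intro x y hxy
      have := hv x y hxy
      grind
    · exact Or.inr (Or.inl ⟨rfl, hk, rfl, rfl⟩)
  · push Not at hε
    exact exists_ccwStep_of_exchange (isMaxClique_thresholdClique _ hv) hF (hnot 2)
      (r' := (2, (i, t i), 1)) (Or.inl ⟨rfl, rfl, rfl, rfl, rfl⟩)
      (thresholdClique_flip hi rfl hε.1 hε.2)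

theorem exists_ccwStep_of_right {E : Finset (ℕ × ℕ)} {F : Set Route} {t u : ℕ → ℕ}
    {ε : ℕ × ℕ → Prop} (hv : ValidThresholds E t u) (hF : F ⊆ thresholdClique E t u ε) {i j : ℕ}
    (hij : (i, j) ∈ E) (hlt : u j < i) (hnot : ∀ a, ((a, (u j, j), 2) : Route) ∉ F) :
    ∃ C', IsMaxClique E C' ∧ F ⊆ C' ∧ CCWStep (thresholdClique E t u ε) C' := by
  classical
  have hj := (hv i j hij).2
  by_cases hε : t (u j) = j → ε (u j, j)
  · obtain ⟨p, hp, hmin⟩ := (E.filter (fun p => p.2 = j ∧ u j < p.1)).exists_min_image Prod.fst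
      ⟨(i, j), by simp [hij, hlt]⟩
    obtain ⟨k, j'⟩ := p
    obtain ⟨hpE, rfl, hk⟩ := Finset.mem_filter.1 hp
    dsimp only at *
    refine exists_ccwStep_of_exchange (isMaxClique_thresholdClique _ ?_) hF (hnot _) ?_
      (thresholdClique_raise_right hj hpE hk
        (fun x hx hx' => hmin (x, j') (by simp [hx, hx'])) hε)
    · intro x y hxy
      have := hv x y hxy
      grind
    · exact Or.inr (Or.inr ⟨rfl, hk, rfl, rfl⟩)
  · push Not at hε
    exact exists_ccwStep_of_exchange (isMaxClique_thresholdClique _ hv) hF (hnot 1)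
      (r' := (2, (u j, j), 1)) (Or.inl ⟨rfl, rfl, rfl, rfl, rfl⟩)
      (thresholdClique_flip hj hε.1 rfl hε.2)

/-- A maximal clique containing `F` can be rotated inside the star of `F` as soon as one of its
routes is clockwise from a route of another clique containing `F`. -/
theorem exists_ccwStep {E : Finset (ℕ × ℕ)} {F C D : Set Route} (hC : IsMaxClique E C)
    (hFC : F ⊆ C) (hD : IsClique E D) (hFD : F ⊆ D) {r r' : Route} (hr : r ∈ C) (hr' : r' ∈ D)
    (hcw : Clockwise r r') : ∃ C', IsMaxClique E C' ∧ F ⊆ C' ∧ CCWStep C C' := by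
  obtain ⟨t, u, ε, hv, rfl⟩ := hC.eq_thresholdClique
  have coh : ∀ f ∈ F, f ≠ r' → ¬ Conflict f r' := fun f hf => hD.2 f (hFD hf) r' hr'
  have hE' : r'.2.1 ∈ E := (hD.1 r' hr').2.1
  obtain ⟨a, ⟨i, j⟩, c⟩ := r
  obtain ⟨a', ⟨i', j'⟩, c'⟩ := r'
  rw [mem_thresholdClique] at hr
  obtain ⟨⟨ha, hij, hc⟩, hr1, hr2, hr3, hr4, hr5⟩ := hr
  simp only [Clockwise, Prod.mk.injEq] at hcw
  dsimp only at hE'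
  rcases hcw with ⟨⟨rfl, rfl⟩, rfl, rfl, rfl, rfl⟩ | ⟨rfl, hlt, rfl, rfl⟩ | ⟨rfl, hlt, rfl, rfl⟩
  · rcases (hr1 rfl).lt_or_eq with h1 | h1
    · refine exists_ccwStep_of_left hv hFC hij h1 fun c hf => coh _ hf (by simp) ?_
      simp [Conflict, h1, h1.ne']
    rcases (hr4 rfl).lt_or_eq with h2 | h2
    · refine exists_ccwStep_of_right hv hFC hij h2 fun a hf => coh _ hf (by simp) ?_
      simp [Conflict, h2, h2.ne]
    · exact exists_ccwStep_of_exchange (isMaxClique_thresholdClique _ hv) hFC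
        (r := (1, (i, j), 2)) (r' := (2, (i, j), 1))
        (fun hf => coh _ hf (by simp) (by simp [Conflict]))
        (Or.inl ⟨rfl, rfl, rfl, rfl, rfl⟩)
        (thresholdClique_flip hij h1.symm h2 fun h => (hr5 h1.symm h2).1 h ⟨rfl, rfl⟩)
  · have h1 : j' < t i := hlt.trans_le (hr1 rfl)
    refine exists_ccwStep_of_left hv hFC hE' h1 fun c hf => coh _ hf (by simp) ?_
    simp [Conflict, h1, h1.ne']
  · have h1 : u j < i' := (hr4 rfl).trans_lt hlt
    refine exists_ccwStep_of_right hv hFC hE' h1 fun a hf => coh _ hf (by simp) ?_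
    simp [Conflict, h1, h1.ne]

theorem Conflict.clockwise_or {r r' : Route} (h : Conflict r r') :
    Clockwise r r' ∨ Clockwise r' r := by
  rcases h with ⟨he, ⟨h1, h2, h3, h4⟩ | ⟨h1, h2, h3, h4⟩⟩ |
    ⟨he, -, ⟨h1, h2, h3⟩ | ⟨h1, h2, h3⟩⟩ | ⟨he, -, ⟨h1, h2, h3⟩ | ⟨h1, h2, h3⟩⟩
  · exact Or.inl (Or.inl ⟨he, h1, h2, h3, h4⟩)
  · exact Or.inr (Or.inl ⟨he.symm, h3, h4, h1, h2⟩)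
  · exact Or.inr (Or.inr (Or.inl ⟨he.symm, h1, h2, h3⟩))
  · exact Or.inl (Or.inr (Or.inl ⟨he, h1, h2, h3⟩))
  · exact Or.inl (Or.inr (Or.inr ⟨he, h1, h2, h3⟩))
  · exact Or.inr (Or.inr (Or.inr ⟨he.symm, h1, h2, h3⟩))

theorem Conflict.symm {r r' : Route} (h : Conflict r r') : Conflict r' r := by
  rcases h with ⟨he, ⟨h1, h2, h3, h4⟩ | ⟨h1, h2, h3, h4⟩⟩ | ⟨he, hne, h⟩ | ⟨he, hne, h⟩
  · exact Or.inl ⟨he.symm, Or.inr ⟨h3, h4, h1, h2⟩⟩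
  · exact Or.inl ⟨he.symm, Or.inl ⟨h3, h4, h1, h2⟩⟩
  · exact Or.inr (Or.inl ⟨he.symm, hne.symm, h.symm⟩)
  · exact Or.inr (Or.inr ⟨he.symm, hne.symm, h.symm⟩)

theorem IsMaxClique.exists_conflict {E : Finset (ℕ × ℕ)} {C D : Set Route}
    (hC : IsMaxClique E C) (hD : IsMaxClique E D) (hne : C ≠ D) :
    ∃ r ∈ C, ∃ r' ∈ D, Conflict r r' := by
  by_contra! h
  have hCD : IsClique E (C ∪ D) := by
    refine ⟨?_, ?_⟩
    · rintro r (hr | hr)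
      exacts [hC.1.1 r hr, hD.1.1 r hr]
    · rintro r (hr | hr) r' (hr' | hr') hrr'
      exacts [hC.1.2 r hr r' hr' hrr', h r hr r' hr', fun hc => h r' hr' r hr hc.symm,
        hD.1.2 r hr r' hr' hrr']
  exact hne ((hC.2 _ hCD Set.subset_union_left).symm.trans (hD.2 _ hCD Set.subset_union_right))

theorem IsClique.finite {E : Finset (ℕ × ℕ)} {C : Set Route} (hC : IsClique E C) : C.Finite := by
  refine (({1, 2} : Finset ℕ) ×ˢ E ×ˢ ({1, 2} : Finset ℕ)).finite_toSet.subset fun r hr => ?_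
  simpa [IsRoute] using hC.1 r hr

/-- A weight on routes that decreases strictly in the counterclockwise direction. -/
def routeWeight (n : ℕ) (r : Route) : ℕ :=
  2 * (r.2.1.2 + (n - r.2.1.1)) + if r.1 = 1 ∧ r.2.2 = 2 then 1 else 0

theorem Clockwise.routeWeight_lt {n : ℕ} {r r' : Route} (h : Clockwise r r')
    (hn : r'.2.1.1 ≤ n) : routeWeight n r' < routeWeight n r := by
  obtain ⟨a, ⟨i, j⟩, c⟩ := r
  obtain ⟨a', ⟨i', j'⟩, c'⟩ := r'
  simp only [Clockwise, Prod.mk.injEq] at h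
  simp only [routeWeight]
  grind

/-- The total weight of the routes of a clique. -/
noncomputable def cliqueWeight (n : ℕ) (C : Set Route) : ℕ := ∑ᶠ r ∈ C, routeWeight n r

theorem cliqueWeight_eq_add {n : ℕ} {C : Set Route} (hC : C.Finite) {r : Route} (hr : r ∈ C) :
    cliqueWeight n C = routeWeight n r + cliqueWeight n (C \ {r}) := by
  conv_lhs => rw [← Set.insert_sdiff_self_of_mem hr]
  exact finsum_mem_insert _ (by simp) hC.sdiff

theorem CCWStep.cliqueWeight_lt {n : ℕ} {E : Finset (ℕ × ℕ)} (hE : ∀ p ∈ E, p.1 ≤ n)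
    {C C' : Set Route} (hC : IsClique E C) (hC' : IsClique E C') (h : CCWStep C C') :
    cliqueWeight n C' < cliqueWeight n C := by
  obtain ⟨r, hr, r', hr', hcw, heq⟩ := h
  rw [cliqueWeight_eq_add hC.finite hr, cliqueWeight_eq_add hC'.finite hr', heq]
  exact Nat.add_lt_add_right (hcw.routeWeight_lt (hE _ (hC'.1 r' hr').2.1)) _

/-- Every coherent set of routes `F` admits a unique maximal clique `Cmax(F)`
reachable from any maximal clique containing `F` by counterclockwise rotations
through cliques containing `F`. -/
theorem cmax_exists_unique (n m : ℕ) (hn : 1 ≤ n) (hm : 1 ≤ m) (E : Finset (ℕ × ℕ))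
    (hE : ∀ p ∈ E, 1 ≤ p.1 ∧ p.1 ≤ n ∧ 1 ≤ p.2 ∧ p.2 ≤ m)
    (hdegS : ∀ i ∈ Finset.Icc 1 n, 2 ≤ (Nbr E i).card)
    (hdegT : ∀ j ∈ Finset.Icc 1 m, 2 ≤ (Nbr' E j).card) :
    ∀ F : Set Route, IsClique E F →
      ∃! Cm : Set Route, IsMaxClique E Cm ∧ F ⊆ Cm ∧
        ∀ C : Set Route, IsMaxClique E C → F ⊆ C →
          ∃ k : ℕ, ∃ c : ℕ → Set Route,
            c 0 = C ∧ c k = Cm ∧ (∀ l ≤ k, IsMaxClique E (c l) ∧ F ⊆ c l) ∧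
            (∀ l < k, CCWStep (c l) (c (l + 1))) := by
  intro F hF
  have hE₁ : ∀ p ∈ E, p.1 ≤ n := fun p hp => (hE p hp).2.1
  obtain ⟨t, u, ε, hv, hsub⟩ := hF.subset_thresholdClique
  obtain ⟨Cm, ⟨hCm, hFCm⟩, hmin⟩ := WellFounded.has_min
    (InvImage.wf (cliqueWeight n) Nat.lt_wfRel.wf) {C | IsMaxClique E C ∧ F ⊆ C}
    ⟨_, isMaxClique_thresholdClique ε hv, hsub⟩
  have hpath : ∀ w C, cliqueWeight n C = w → IsMaxClique E C → F ⊆ C →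
      ∃ k : ℕ, ∃ c : ℕ → Set Route,
        c 0 = C ∧ c k = Cm ∧ (∀ l ≤ k, IsMaxClique E (c l) ∧ F ⊆ c l) ∧
        (∀ l < k, CCWStep (c l) (c (l + 1))) := by
    intro w
    induction w using Nat.strong_induction_on with
    | _ w ih =>
      rintro C rfl hC hFC
      by_cases hne : C = Cm
      · exact ⟨0, fun _ => C, rfl, hne, fun _ _ => ⟨hC, hFC⟩, by simp⟩
      obtain ⟨r, hr, r', hr', hconf⟩ := hC.exists_conflict hCm hne
      rcases hconf.clockwise_or with hcw | hcw
      · obtain ⟨C', hC', hFC', hstep⟩ := exists_ccwStep hC hFC hCm.1 hFCm hr hr' hcw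
        obtain ⟨k, c, h0, hk, hc, hs⟩ :=
          ih _ (hstep.cliqueWeight_lt hE₁ hC.1 hC'.1) C' rfl hC' hFC'
        refine ⟨k + 1, fun l => Nat.casesOn l C c, rfl, hk, ?_, ?_⟩
        · rintro (_ | l) hl
          exacts [⟨hC, hFC⟩, hc l (by omega)]
        · rintro (_ | l) hl
          · change CCWStep C (c 0)
            rwa [h0]
          · exact hs l (by omega)
      · obtain ⟨C', hC', hFC', hstep⟩ := exists_ccwStep hCm hFCm hC.1 hFC hr' hr hcw
        exact (hmin C' ⟨hC', hFC'⟩ (hstep.cliqueWeight_lt hE₁ hCm.1 hC'.1)).elim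
  refine ⟨Cm, ⟨hCm, hFCm, fun C => hpath _ C rfl⟩, ?_⟩
  rintro D ⟨-, -, hD⟩
  obtain ⟨k, c, h0, hk, hc, hs⟩ := hD Cm hCm hFCm
  rcases k with _ | k
  · exact hk.symm.trans h0
  · have hstep := hs 0 k.succ_pos
    have h1 := hc 1 (by omega)
    rw [h0] at hstep
    exact (hmin _ h1 (hstep.cliqueWeight_lt hE₁ hCm.1 h1.1.1)).elim
end

section
/- For every clique vector v, the number of maximal cliques C' that are obtained from φ(v) by a single counterclockwise rotation equals the number of edges of the matching ψ(v). -/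
open Finset Filter Pointwise

/-- A clique vector `(f, g, s)` for the bipartite graph `H`; values outside the
domains are normalized (to `0`, resp. `false`). -/
structure CliqueVec (n m : ℕ) (E : Finset (ℕ × ℕ)) where
  f : ℕ → ℕ
  g : ℕ → ℕ
  s : ℕ × ℕ → Bool
  hf : ∀ i ∈ Finset.Icc 1 n, (i, f i) ∈ E
  hg : ∀ j ∈ Finset.Icc 1 m, (g j, j) ∈ E
  hs : ∀ p ∈ E, s p = true → f p.1 = p.2 ∧ g p.2 = p.1
  hf' : ∀ i ∉ Finset.Icc 1 n, f i = 0
  hg' : ∀ j ∉ Finset.Icc 1 m, g j = 0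
  hs' : ∀ p ∉ E, s p = false

/-- The clique map `φ`. -/
def phi {n m : ℕ} {E : Finset (ℕ × ℕ)} (v : CliqueVec n m E) : Set Route :=
  { r | ∃ a i j c : ℕ, r = (a, (i, j), c) ∧ (i, j) ∈ E ∧
    ((v.f i ≠ j ∧ v.g j ≠ i ∧
        a = (if v.f i < j then 2 else 1) ∧ c = (if v.g j < i then 2 else 1)) ∨
     (v.f i = j ∧ v.g j ≠ i ∧ (a = 1 ∨ a = 2) ∧ c = (if v.g j < i then 2 else 1)) ∨
     (v.g j = i ∧ v.f i ≠ j ∧ a = (if v.f i < j then 2 else 1) ∧ (c = 1 ∨ c = 2)) ∨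
     (v.f i = j ∧ v.g j = i ∧ v.s (i, j) = false ∧
        ((a = 1 ∧ c = 1) ∨ (a = 1 ∧ c = 2) ∨ (a = 2 ∧ c = 2))) ∨
     (v.f i = j ∧ v.g j = i ∧ v.s (i, j) = true ∧
        ((a = 1 ∧ c = 1) ∨ (a = 2 ∧ c = 1) ∨ (a = 2 ∧ c = 2)))) }

/-- Edges of the almost-degree-whiskered graph `W(H)`:
`Sum.inl (i,j)` is the edge `{i,j}` of `H`;
`Sum.inr (Sum.inl (i,j))` is the pendant edge `{i, w_{i,j}}`;
`Sum.inr (Sum.inr (j,i))` is the pendant edge `{j, w'_{j,i}}`. -/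
abbrev WEdge : Type := (ℕ × ℕ) ⊕ ((ℕ × ℕ) ⊕ (ℕ × ℕ))

def IsWEdge (E : Finset (ℕ × ℕ)) : WEdge → Prop
  | Sum.inl p => p ∈ E
  | Sum.inr (Sum.inl p) => p ∈ E ∧ ∃ j' ∈ Nbr E p.1, j' < p.2
  | Sum.inr (Sum.inr q) => (q.2, q.1) ∈ E ∧ ∃ i' ∈ Nbr' E q.1, q.2 < i'

/-- The `H`-vertex of the left shore covered by an edge of `W(H)`, if any. -/
def leftV : WEdge → Option ℕ
  | Sum.inl p => some p.1
  | Sum.inr (Sum.inl p) => some p.1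
  | Sum.inr (Sum.inr _) => none

/-- The `H`-vertex of the right shore covered by an edge of `W(H)`, if any. -/
def rightV : WEdge → Option ℕ
  | Sum.inl p => some p.2
  | Sum.inr (Sum.inl _) => none
  | Sum.inr (Sum.inr q) => some q.1

/-- A matching of `W(H)`: a set of pairwise disjoint edges of `W(H)`.
(Leaf vertices are covered by at most one edge label automatically.) -/
def IsMatching (E : Finset (ℕ × ℕ)) (M : Set WEdge) : Prop :=
  (∀ e ∈ M, IsWEdge E e) ∧
  ∀ e ∈ M, ∀ e' ∈ M, e ≠ e' →
    (leftV e = none ∨ leftV e ≠ leftV e') ∧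
    (rightV e = none ∨ rightV e ≠ rightV e')

/-- `mCount E k` is `m_k`, the number of `k`-matchings of `W(H)`. -/
noncomputable def mCount (E : Finset (ℕ × ℕ)) (k : ℕ) : ℕ :=
  {M : Set WEdge | IsMatching E M ∧ M.ncard = k}.ncard

/-- The matching map `ψ`. -/
def psi {n m : ℕ} {E : Finset (ℕ × ℕ)} (v : CliqueVec n m E) : Set WEdge :=
  { e | (∃ i ∈ Finset.Icc 1 n, v.g (v.f i) ≠ i ∧ (∃ j' ∈ Nbr E i, j' < v.f i) ∧
          e = Sum.inr (Sum.inl (i, v.f i))) ∨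
        (∃ j ∈ Finset.Icc 1 m, v.f (v.g j) ≠ j ∧ (∃ i' ∈ Nbr' E j, v.g j < i') ∧
          e = Sum.inr (Sum.inr (j, v.g j))) ∨
        (∃ p ∈ E, v.f p.1 = p.2 ∧ v.g p.2 = p.1 ∧ v.s p = false ∧ e = Sum.inl p) ∨
        (∃ p ∈ E, v.f p.1 = p.2 ∧ v.g p.2 = p.1 ∧ v.s p = true ∧
          (((∃ j' ∈ Nbr E p.1, j' < p.2) ∧ e = Sum.inr (Sum.inl p)) ∨
           ((∃ i' ∈ Nbr' E p.2, p.1 < i') ∧ e = Sum.inr (Sum.inr (p.2, p.1))))) }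

namespace CliqueVec

variable {n m : ℕ} {E : Finset (ℕ × ℕ)}

theorem mem_phi {v : CliqueVec n m E} {a i j c : ℕ} :
    (a, (i, j), c) ∈ phi v ↔ (i, j) ∈ E ∧ (a = 1 ∨ a = 2) ∧ (c = 1 ∨ c = 2) ∧
      (v.f i < j → a = 2) ∧ (j < v.f i → a = 1) ∧ (v.g j < i → c = 2) ∧ (i < v.g j → c = 1) ∧
      (v.f i = j → v.g j = i → v.s (i, j) = false → ¬ (a = 2 ∧ c = 1)) ∧
      (v.f i = j → v.g j = i → v.s (i, j) = true → ¬ (a = 1 ∧ c = 2)) := by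
  constructor
  · rintro ⟨a', i', j', c', h, hE, hr⟩
    simp only [Prod.mk.injEq] at h
    obtain ⟨rfl, ⟨rfl, rfl⟩, rfl⟩ := h
    refine ⟨hE, ?_⟩
    cases hs : v.s (i, j) <;> grind
  · rintro ⟨hE, h⟩
    refine ⟨a, i, j, c, rfl, hE, ?_⟩
    cases hs : v.s (i, j) <;> grind

theorem mem_Nbr {i j : ℕ} : j ∈ Nbr E i ↔ (i, j) ∈ E := by
  simp [Nbr]

theorem mem_Nbr' {i j : ℕ} : i ∈ Nbr' E j ↔ (i, j) ∈ E := by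
  simp [Nbr']

/-- The edges of `H` join `{1, …, n}` to `{1, …, m}`. -/
def InShores (n m : ℕ) (E : Finset (ℕ × ℕ)) : Prop :=
  ∀ p ∈ E, 1 ≤ p.1 ∧ p.1 ≤ n ∧ 1 ≤ p.2 ∧ p.2 ≤ m

theorem InShores.left_mem (hE : InShores n m E) {i j : ℕ} (h : (i, j) ∈ E) :
    i ∈ Finset.Icc 1 n := by
  have := hE _ h
  simp_all

theorem InShores.right_mem (hE : InShores n m E) {i j : ℕ} (h : (i, j) ∈ E) :
    j ∈ Finset.Icc 1 m := by
  have := hE _ h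
  simp_all

/-- An edge `(i, j)` carries a route of `φ(v)`, with any first entry allowed by `f`. -/
theorem exists_mem_phi_left (v : CliqueVec n m E) {a i j : ℕ} (h : (i, j) ∈ E)
    (ha : a = 1 ∨ a = 2) (h₁ : v.f i < j → a = 2) (h₂ : j < v.f i → a = 1) :
    ∃ c, (a, (i, j), c) ∈ phi v := by
  by_cases hc : v.g j < i ∨ (v.g j = i ∧ a = 2)
  · exact ⟨2, mem_phi.2 (by grind)⟩
  · exact ⟨1, mem_phi.2 (by grind)⟩

/-- An edge `(i, j)` carries a route of `φ(v)`, with any last entry allowed by `g`. -/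
theorem exists_mem_phi_right (v : CliqueVec n m E) {i j c : ℕ} (h : (i, j) ∈ E)
    (hc : c = 1 ∨ c = 2) (h₁ : v.g j < i → c = 2) (h₂ : i < v.g j → c = 1) :
    ∃ a, (a, (i, j), c) ∈ phi v := by
  by_cases ha : v.f i < j ∨ (v.f i = j ∧ c = 2)
  · exact ⟨2, mem_phi.2 (by grind)⟩
  · exact ⟨1, mem_phi.2 (by grind)⟩

theorem isClique_phi (v : CliqueVec n m E) : IsClique E (phi v) := by
  constructor
  · rintro ⟨a, ⟨i, j⟩, c⟩ h
    rw [mem_phi] at h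
    exact ⟨h.2.1, h.1, h.2.2.1⟩
  · rintro ⟨a, ⟨i, j⟩, c⟩ h ⟨a', ⟨i', j'⟩, c'⟩ h' - hc
    rw [mem_phi] at h h'
    simp only [Conflict, Prod.mk.injEq] at hc
    rcases hc with ⟨⟨rfl, rfl⟩, hc⟩ | ⟨rfl, hj, hc⟩ | ⟨rfl, hi, hc⟩
    · cases hs : v.s (i, j) <;> grind
    · grind
    · grind

theorem isMaxClique_phi (hE : InShores n m E) (v : CliqueVec n m E) :
    IsMaxClique E (phi v) := by
  refine ⟨isClique_phi v, fun C hC hsub => (hsub.antisymm ?_).symm⟩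
  rintro ⟨a, ⟨i, j⟩, c⟩ hr
  obtain ⟨ha, hij, hc⟩ := hC.1 _ hr
  have hcon : ∀ r ∈ phi v, r ≠ (a, (i, j), c) → ¬ Conflict (a, (i, j), c) r :=
    fun r h hne => hC.2 _ hr r (hsub h) hne.symm
  have hi := v.hf i (hE.left_mem hij)
  have hj := v.hg j (hE.right_mem hij)
  obtain ⟨c₁, h₁⟩ := v.exists_mem_phi_left (a := 1) hi (by simp) (by simp) (by simp)
  obtain ⟨c₂, h₂⟩ := v.exists_mem_phi_left (a := 2) hi (by simp) (by simp) (by simp)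
  obtain ⟨a₁, h₃⟩ := v.exists_mem_phi_right (c := 1) hj (by simp) (by simp) (by simp)
  obtain ⟨a₂, h₄⟩ := v.exists_mem_phi_right (c := 2) hj (by simp) (by simp) (by simp)
  have k₁ := hcon _ h₁
  have k₂ := hcon _ h₂
  have k₃ := hcon _ h₃
  have k₄ := hcon _ h₄
  simp only [Conflict, ne_eq, Prod.mk.injEq] at k₁ k₂ k₃ k₄ ha hc
  refine mem_phi.2 ⟨hij, ha, hc, ?_, ?_, ?_, ?_, ?_, ?_⟩
  · grind
  · grind
  · grind
  · grind
  · rintro hf hg hs ⟨rfl, rfl⟩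
    have := hcon (1, (i, j), 2) (mem_phi.2 (by grind))
    simp [Conflict] at this
  · rintro hf hg hs ⟨rfl, rfl⟩
    have := hcon (2, (i, j), 1) (mem_phi.2 (by grind))
    simp [Conflict] at this

/-- The largest neighbor of `i` below `j`. -/
noncomputable def predNbr (E : Finset (ℕ × ℕ)) (i j : ℕ) : ℕ := sSup {l | (i, l) ∈ E ∧ l < j}

/-- The smallest neighbor of `j` above `i`. -/
noncomputable def succNbr (E : Finset (ℕ × ℕ)) (i j : ℕ) : ℕ := sInf {k | (k, j) ∈ E ∧ i < k}

theorem bddAbove_nbr_lt (i j : ℕ) : BddAbove {l | (i, l) ∈ E ∧ l < j} :=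
  ⟨j, fun _ h => h.2.le⟩

theorem predNbr_spec {i j l : ℕ} (h : (i, l) ∈ E) (hl : l < j) :
    (i, predNbr E i j) ∈ E ∧ predNbr E i j < j :=
  Nat.sSup_mem (s := {l | (i, l) ∈ E ∧ l < j}) ⟨l, h, hl⟩ (bddAbove_nbr_lt i j)

theorem le_predNbr {i j l : ℕ} (h : (i, l) ∈ E) (hl : l < j) : l ≤ predNbr E i j :=
  le_csSup (bddAbove_nbr_lt i j) ⟨h, hl⟩

theorem succNbr_spec {i j k : ℕ} (h : (k, j) ∈ E) (hk : i < k) :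
    (succNbr E i j, j) ∈ E ∧ i < succNbr E i j :=
  Nat.sInf_mem (s := {k | (k, j) ∈ E ∧ i < k}) ⟨k, h, hk⟩

theorem succNbr_le {i j k : ℕ} (h : (k, j) ∈ E) (hk : i < k) : succNbr E i j ≤ k :=
  Nat.sInf_le ⟨h, hk⟩

/-- Lower the value of `f` at `i` to `j`. -/
def updateLeft (v : CliqueVec n m E) (i j : ℕ) (hi : i ∈ Finset.Icc 1 n) (hij : (i, j) ∈ E)
    (hne : v.f i ≠ j) : CliqueVec n m E where
  f := Function.update v.f i j
  g := v.g
  s := Function.update v.s (i, v.f i) false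
  hf := by
    intro k hk
    by_cases h : k = i
    · subst h; simpa
    · simpa [h] using v.hf k hk
  hg := v.hg
  hs := by
    rintro ⟨k, l⟩ hp
    have := v.hs _ hp
    simp only [Function.update_apply, Prod.mk.injEq]
    grind
  hf' := by
    intro k hk
    have : k ≠ i := by rintro rfl; exact hk hi
    simpa [this] using v.hf' k hk
  hg' := v.hg'
  hs' := by
    intro p hp
    have := v.hs' p hp
    simp only [Function.update_apply]
    grind

/-- Raise the value of `g` at `j` to `i`. -/
def updateRight (v : CliqueVec n m E) (i j : ℕ) (hj : j ∈ Finset.Icc 1 m) (hij : (i, j) ∈ E)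
    (hne : v.g j ≠ i) : CliqueVec n m E where
  f := v.f
  g := Function.update v.g j i
  s := Function.update v.s (v.g j, j) false
  hf := v.hf
  hg := by
    intro k hk
    by_cases h : k = j
    · subst h; simpa
    · simpa [h] using v.hg k hk
  hs := by
    rintro ⟨k, l⟩ hp
    have := v.hs _ hp
    simp only [Function.update_apply, Prod.mk.injEq]
    grind
  hf' := v.hf'
  hg' := by
    intro k hk
    have : k ≠ j := by rintro rfl; exact hk hj
    simpa [this] using v.hg' k hk
  hs' := by
    intro p hp
    have := v.hs' p hp
    simp only [Function.update_apply]
    grind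

/-- Turn the sign of the edge `(i, j)` to `+`. -/
def updateSign (v : CliqueVec n m E) (i j : ℕ) (hij : (i, j) ∈ E)
    (hf : v.f i = j) (hg : v.g j = i) : CliqueVec n m E where
  f := v.f
  g := v.g
  s := Function.update v.s (i, j) true
  hf := v.hf
  hg := v.hg
  hs := by
    rintro ⟨k, l⟩ hp
    have := v.hs _ hp
    simp only [Function.update_apply, Prod.mk.injEq]
    grind
  hf' := v.hf'
  hg' := v.hg'
  hs' := by
    intro p hp
    have := v.hs' p hp
    simp only [Function.update_apply]
    grind

theorem mem_psi_inl {v : CliqueVec n m E} {i j : ℕ} :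
    Sum.inl (i, j) ∈ psi v ↔ (i, j) ∈ E ∧ v.f i = j ∧ v.g j = i ∧ v.s (i, j) = false := by
  simp only [psi, Set.mem_ofPred_eq]
  grind

theorem mem_psi_inr_inl (hE : InShores n m E) {v : CliqueVec n m E} {i j : ℕ} :
    Sum.inr (Sum.inl (i, j)) ∈ psi v ↔ (i, j) ∈ E ∧ v.f i = j ∧
      (v.g j = i → v.s (i, j) = true) ∧ ∃ l, (i, l) ∈ E ∧ l < j := by
  have h₁ := @v.hf i
  have h₂ : (i, j) ∈ E → i ∈ Finset.Icc 1 n := hE.left_mem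
  simp only [psi, Set.mem_ofPred_eq, mem_Nbr, mem_Nbr', reduceCtorEq, and_false, exists_const,
    false_or, or_false, Sum.inr.injEq, Sum.inl.injEq, Prod.mk.injEq, Prod.exists]
  constructor
  · grind
  · rintro ⟨hij, hf, hs, hl⟩
    by_cases hg : v.g j = i <;> grind

theorem mem_psi_inr_inr (hE : InShores n m E) {v : CliqueVec n m E} {i j : ℕ} :
    Sum.inr (Sum.inr (j, i)) ∈ psi v ↔ (i, j) ∈ E ∧ v.g j = i ∧
      (v.f i = j → v.s (i, j) = true) ∧ ∃ k, (k, j) ∈ E ∧ i < k := by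
  have h₁ := @v.hg j
  have h₂ : (i, j) ∈ E → j ∈ Finset.Icc 1 m := hE.right_mem
  simp only [psi, Set.mem_ofPred_eq, mem_Nbr, mem_Nbr', reduceCtorEq, and_false, exists_const,
    false_or, Sum.inr.injEq, Prod.mk.injEq, Prod.exists]
  constructor
  · grind
  · rintro ⟨hij, hf, hs, hl⟩
    by_cases hg : v.f i = j <;> grind

/-- The route leaving `φ(v)` in the rotation that belongs to an edge of `ψ(v)`. -/
def removedRoute (v : CliqueVec n m E) : WEdge → Route
  | Sum.inl (i, j) => (1, (i, j), 2)
  | Sum.inr (Sum.inl (i, j)) => (1, (i, j), if v.g j < i then 2 else 1)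
  | Sum.inr (Sum.inr (j, i)) => (if v.f i ≤ j then 2 else 1, (i, j), 2)

/-- The route entering `φ(v)` in the rotation that belongs to an edge of `ψ(v)`. -/
noncomputable def addedRoute (v : CliqueVec n m E) : WEdge → Route
  | Sum.inl (i, j) => (2, (i, j), 1)
  | Sum.inr (Sum.inl (i, j)) =>
    (2, (i, predNbr E i j), if v.g (predNbr E i j) ≤ i then 2 else 1)
  | Sum.inr (Sum.inr (j, i)) =>
    (if v.f (succNbr E i j) < j then 2 else 1, (succNbr E i j, j), 1)

/-- The maximal clique obtained from `φ(v)` by the rotation that belongs to an edge of `ψ(v)`. -/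
def rotate (v : CliqueVec n m E) (e : WEdge) : Set Route :=
  insert (v.addedRoute e) (phi v \ {v.removedRoute e})

theorem removedRoute_mem_phi (hE : InShores n m E) (v : CliqueVec n m E) {e : WEdge}
    (he : e ∈ psi v) : v.removedRoute e ∈ phi v := by
  rcases e with ⟨i, j⟩ | ⟨i, j⟩ | ⟨j, i⟩
  · rw [mem_psi_inl] at he
    exact mem_phi.2 (by grind)
  · rw [mem_psi_inr_inl hE] at he
    exact mem_phi.2 (by grind)
  · rw [mem_psi_inr_inr hE] at he
    exact mem_phi.2 (by grind)

theorem clockwise_removedRoute_addedRoute (hE : InShores n m E) (v : CliqueVec n m E) {e : WEdge}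
    (he : e ∈ psi v) : Clockwise (v.removedRoute e) (v.addedRoute e) := by
  rcases e with ⟨i, j⟩ | ⟨i, j⟩ | ⟨j, i⟩
  · simp [Clockwise, removedRoute, addedRoute]
  · obtain ⟨-, -, -, l, hl, hlt⟩ := (mem_psi_inr_inl hE).1 he
    simp [Clockwise, removedRoute, addedRoute, predNbr_spec hl hlt]
  · obtain ⟨-, -, -, k, hk, hlt⟩ := (mem_psi_inr_inr hE).1 he
    simp [Clockwise, removedRoute, addedRoute, succNbr_spec hk hlt]

theorem addedRoute_notMem_phi (hE : InShores n m E) (v : CliqueVec n m E) {e : WEdge}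
    (he : e ∈ psi v) : v.addedRoute e ∉ phi v := by
  rcases e with ⟨i, j⟩ | ⟨i, j⟩ | ⟨j, i⟩
  · rw [mem_psi_inl] at he
    rw [addedRoute, mem_phi]
    grind
  · obtain ⟨-, hf, -, l, hl, hlt⟩ := (mem_psi_inr_inl hE).1 he
    have := predNbr_spec hl hlt
    rw [addedRoute, mem_phi]
    grind
  · obtain ⟨-, hg, -, k, hk, hlt⟩ := (mem_psi_inr_inr hE).1 he
    have := succNbr_spec hk hlt
    rw [addedRoute, mem_phi]
    grind

theorem exists_phi_eq_rotate (hE : InShores n m E) (v : CliqueVec n m E) {e : WEdge}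
    (he : e ∈ psi v) : ∃ w : CliqueVec n m E, phi w = v.rotate e := by
  rcases e with ⟨i, j⟩ | ⟨i, j⟩ | ⟨j, i⟩
  · obtain ⟨hij, hf, hg, hs⟩ := mem_psi_inl.1 he
    refine ⟨v.updateSign i j hij hf hg, ?_⟩
    ext ⟨a, ⟨k, l⟩, c⟩
    simp only [rotate, Set.mem_insert_iff, Set.mem_sdiff, Set.mem_singleton_iff, mem_phi,
      removedRoute, addedRoute, updateSign, Function.update_apply, Prod.mk.injEq]
    grind
  · obtain ⟨hij, hf, hs, l, hl, hlt⟩ := (mem_psi_inr_inl hE).1 he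
    obtain ⟨hp, hlt'⟩ := predNbr_spec hl hlt
    have hmax : ∀ l, (i, l) ∈ E → l < j → l ≤ predNbr E i j := fun _ => le_predNbr
    have hsq : v.s (i, predNbr E i j) ≠ true := fun h => by
      have := v.hs _ hp h
      grind
    refine ⟨v.updateLeft i (predNbr E i j) (hE.left_mem hij) hp (by omega), ?_⟩
    ext ⟨a, ⟨k, l⟩, c⟩
    have := hmax l
    simp only [rotate, Set.mem_insert_iff, Set.mem_sdiff, Set.mem_singleton_iff, mem_phi,
      removedRoute, addedRoute, updateLeft, Function.update_apply, Prod.mk.injEq]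
    clear hmax he hE hl hlt
    generalize predNbr E i j = q at *
    by_cases hk : k = i
    · subst hk
      rcases lt_trichotomy l j with h | rfl | h
      · rcases eq_or_ne l q with rfl | hq <;> grind
      · cases hsl : v.s (k, l) <;> grind
      · have hql : q < l := hlt'.trans h
        simp [hf, h, h.not_gt, h.ne, h.ne', hql, hql.not_gt, hql.ne, hql.ne']
    · simp [hk]
  · obtain ⟨hij, hg, hs, k, hk, hlt⟩ := (mem_psi_inr_inr hE).1 he
    obtain ⟨hp, hlt'⟩ := succNbr_spec hk hlt
    have hmin : ∀ k, (k, j) ∈ E → i < k → succNbr E i j ≤ k := fun _ => succNbr_le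
    have hsq : v.s (succNbr E i j, j) ≠ true := fun h => by
      have := v.hs _ hp h
      grind
    refine ⟨v.updateRight (succNbr E i j) j (hE.right_mem hij) hp (by omega), ?_⟩
    ext ⟨a, ⟨k, l⟩, c⟩
    have := hmin k
    simp only [rotate, Set.mem_insert_iff, Set.mem_sdiff, Set.mem_singleton_iff, mem_phi,
      removedRoute, addedRoute, updateRight, Function.update_apply, Prod.mk.injEq]
    clear hmin he hE hk hlt
    generalize succNbr E i j = q at *
    by_cases hl : l = j
    · subst hl
      rcases lt_trichotomy k i with h | rfl | h
      · have hkq : k < q := h.trans hlt'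
        simp [hg, h, h.not_gt, h.ne, h.ne', hkq, hkq.not_gt, hkq.ne, hkq.ne']
      · cases hsl : v.s (k, l) <;> grind
      · rcases eq_or_ne k q with rfl | hq <;> grind
    · simp [hl]

theorem rotate_injOn (hE : InShores n m E) (v : CliqueVec n m E) :
    Set.InjOn v.rotate (psi v) := by
  have hdiff : ∀ e ∈ psi v, phi v \ v.rotate e = {v.removedRoute e} := by
    intro e he
    have h₁ := v.removedRoute_mem_phi hE he
    have h₂ := v.addedRoute_notMem_phi hE he
    ext r
    simp only [rotate, Set.mem_sdiff, Set.mem_insert_iff, Set.mem_singleton_iff]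
    grind
  intro e he e' he' heq
  have hr : v.removedRoute e = v.removedRoute e' := by
    rw [← Set.singleton_eq_singleton_iff, ← hdiff e he, ← hdiff e' he', heq]
  clear heq hdiff
  rcases e with ⟨i, j⟩ | ⟨i, j⟩ | ⟨j, i⟩ <;> rcases e' with ⟨i', j'⟩ | ⟨i', j'⟩ | ⟨j', i'⟩ <;>
    simp only [mem_psi_inl, mem_psi_inr_inl hE, mem_psi_inr_inr hE] at he he' <;>
    simp only [removedRoute, Prod.mk.injEq] at hr <;> grind

theorem not_conflict_of_isClique_insert {C : Set Route} {r : Route}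
    (h : IsClique E (insert r C)) (hr : r ∉ C) {q : Route} (hq : q ∈ C) : ¬ Conflict r q :=
  h.2 _ (Set.mem_insert _ _) _ (Set.mem_insert_of_mem _ hq) (by rintro rfl; exact hr hq)

/-- Every counterclockwise rotation of `φ(v)` belongs to an edge of `ψ(v)`. -/
theorem exists_rotate_eq (hE : InShores n m E) (v : CliqueVec n m E) {r r' : Route}
    (hr : r ∈ phi v) (hcw : Clockwise r r') (hr' : r' ∉ phi v \ {r})
    (hC : IsClique E (insert r' (phi v \ {r}))) :
    ∃ e ∈ psi v, v.removedRoute e = r ∧ v.addedRoute e = r' := by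
  obtain ⟨a, ⟨i, j⟩, c⟩ := r
  obtain ⟨a', ⟨i', j'⟩, c'⟩ := r'
  have hcon : ∀ q ∈ phi v, q ≠ (a, (i, j), c) → ¬ Conflict (a', (i', j'), c') q :=
    fun q hq hne => not_conflict_of_isClique_insert hC hr' ⟨hq, hne⟩
  obtain ⟨ha', hij', hc'⟩ := hC.1 _ (Set.mem_insert _ _)
  simp only at ha' hij' hc'
  have hmem := mem_phi.1 hr
  obtain ⟨hij, ha, hc, hm⟩ := hmem
  simp only [Clockwise] at hcw
  have hfi := v.hf i (hE.left_mem hij)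
  have hgj := v.hg j (hE.right_mem hij)
  have hfi' := v.hf i' (hE.left_mem hij')
  have hgj' := v.hg j' (hE.right_mem hij')
  rcases hcw with ⟨h, rfl, rfl, rfl, rfl⟩ | ⟨rfl, hj, rfl, rfl⟩ | ⟨rfl, hi, rfl, rfl⟩
  · obtain ⟨rfl, rfl⟩ := Prod.mk.inj h
    have hf : v.f i = j := by
      by_contra hne
      obtain ⟨c₁, h₁⟩ := v.exists_mem_phi_left (a := 1) hfi (by simp) (by simp) (by simp)
      have := hcon _ h₁ (by grind)
      simp only [Conflict] at this
      grind
    have hg : v.g j = i := by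
      by_contra hne
      obtain ⟨a₁, h₁⟩ := v.exists_mem_phi_right (c := 2) hgj (by simp) (by simp) (by simp)
      have := hcon _ h₁ (by grind)
      simp only [Conflict] at this
      grind
    refine ⟨Sum.inl (i, j), mem_psi_inl.2 ⟨hij, hf, hg, ?_⟩, rfl, rfl⟩
    grind
  · have hf : v.f i = j := by
      by_contra hne
      obtain ⟨c₁, h₁⟩ := v.exists_mem_phi_left (a := 1) hfi (by simp) (by simp) (by simp)
      have := hcon _ h₁ (by grind)
      simp only [Conflict] at this
      grind
    have honly : ∀ d, (1, (i, j), d) ∈ phi v → d = c := by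
      intro d hd
      by_contra hne
      have := hcon _ hd (by grind)
      simp only [Conflict] at this
      grind
    have hs : v.g j = i → v.s (i, j) = true := by
      intro hg
      by_contra hs
      have h₁ := honly 1 (mem_phi.2 (by grind))
      have h₂ := honly 2 (mem_phi.2 (by grind))
      omega
    refine ⟨Sum.inr (Sum.inl (i, j)), (mem_psi_inr_inl hE).2 ⟨hij, hf, hs, j', hij', hj⟩, ?_, ?_⟩
    · simp only [removedRoute, Prod.mk.injEq]
      grind
    · obtain ⟨hp, hlt⟩ := predNbr_spec hij' hj
      have hpred : predNbr E i j = j' := by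
        by_contra hne
        obtain ⟨c₁, h₁⟩ := v.exists_mem_phi_left (a := 1) hp (by simp) (by omega) (by simp)
        have hle := le_predNbr hij' hj
        have := hcon _ h₁ (by grind)
        simp only [Conflict] at this
        grind
      simp only [addedRoute, hpred, Prod.mk.injEq, true_and]
      split_ifs with hg
      · by_contra hne
        obtain ⟨a₁, h₁⟩ : ∃ a₁, (a₁, (v.g j', j'), 2) ∈ phi v ∧ (v.g j' = i → a₁ = 1) := by
          by_cases hgi : v.g j' = i
          · exact ⟨1, mem_phi.2 (by grind), fun _ => rfl⟩
          · obtain ⟨a₁, h₁⟩ := v.exists_mem_phi_right (c := 2) hgj' (by simp) (by simp) (by simp)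
            exact ⟨a₁, h₁, fun h => absurd h hgi⟩
        have := hcon _ h₁.1 (by grind)
        simp only [Conflict, Prod.mk.injEq] at this
        grind
      · by_contra hne
        obtain ⟨a₁, h₁⟩ := v.exists_mem_phi_right (c := 1) hgj' (by simp) (by simp) (by simp)
        have := hcon _ h₁ (by grind)
        simp only [Conflict] at this
        grind
  · have hg : v.g j = i := by
      by_contra hne
      obtain ⟨a₁, h₁⟩ := v.exists_mem_phi_right (c := 2) hgj (by simp) (by simp) (by simp)
      have := hcon _ h₁ (by grind)
      simp only [Conflict] at this
      grind
    have honly : ∀ d, (d, (i, j), 2) ∈ phi v → d = a := by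
      intro d hd
      by_contra hne
      have := hcon _ hd (by grind)
      simp only [Conflict] at this
      grind
    have hs : v.f i = j → v.s (i, j) = true := by
      intro hf
      by_contra hs
      have h₁ := honly 1 (mem_phi.2 (by grind))
      have h₂ := honly 2 (mem_phi.2 (by grind))
      omega
    refine ⟨Sum.inr (Sum.inr (j, i)), (mem_psi_inr_inr hE).2 ⟨hij, hg, hs, i', hij', hi⟩, ?_, ?_⟩
    · simp only [removedRoute, Prod.mk.injEq]
      grind
    · obtain ⟨hp, hlt⟩ := succNbr_spec hij' hi
      have hsucc : succNbr E i j = i' := by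
        by_contra hne
        obtain ⟨a₁, h₁⟩ := v.exists_mem_phi_right (c := 2) hp (by simp) (by simp) (by omega)
        have hle := succNbr_le hij' hi
        have := hcon _ h₁ (by grind)
        simp only [Conflict] at this
        grind
      simp only [addedRoute, hsucc, Prod.mk.injEq, and_true]
      split_ifs with hf
      · by_contra hne
        obtain ⟨c₁, h₁⟩ := v.exists_mem_phi_left (a := 2) hfi' (by simp) (by simp) (by simp)
        have := hcon _ h₁ (by grind)
        simp only [Conflict] at this
        grind
      · by_contra hne
        obtain ⟨c₁, h₁⟩ : ∃ c₁, (1, (i', v.f i'), c₁) ∈ phi v ∧ (v.f i' = j → c₁ = 2) := by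
          by_cases hfj : v.f i' = j
          · exact ⟨2, mem_phi.2 (by grind), fun _ => rfl⟩
          · obtain ⟨c₁, h₁⟩ := v.exists_mem_phi_left (a := 1) hfi' (by simp) (by simp) (by simp)
            exact ⟨c₁, h₁, fun h => absurd h hfj⟩
        have := hcon _ h₁.1 (by grind)
        simp only [Conflict, Prod.mk.injEq] at this
        grind

end CliqueVec

/-- The number of maximal cliques obtained from `φ(v)` by a single
counterclockwise rotation equals the number of edges of the matching `ψ(v)`. -/
theorem covers_eq_matching_size (n m : ℕ) (hn : 1 ≤ n) (hm : 1 ≤ m) (E : Finset (ℕ × ℕ))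
    (hE : ∀ p ∈ E, 1 ≤ p.1 ∧ p.1 ≤ n ∧ 1 ≤ p.2 ∧ p.2 ≤ m)
    (hdegS : ∀ i ∈ Finset.Icc 1 n, 2 ≤ (Nbr E i).card)
    (hdegT : ∀ j ∈ Finset.Icc 1 m, 2 ≤ (Nbr' E j).card) :
    ∀ v : CliqueVec n m E,
      {C : Set Route | IsMaxClique E C ∧ CCWStep (phi v) C}.ncard = (psi v).ncard := by
  intro v
  rw [← (v.rotate_injOn hE).ncard_image]
  congr 1
  ext C
  constructor
  · rintro ⟨hC, r, hr, r', hr', hcw, heq⟩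
    have hCeq : C = insert r' (phi v \ {r}) := by
      rw [heq, Set.insert_sdiff_singleton, Set.insert_eq_of_mem hr']
    obtain ⟨e, he, rfl, rfl⟩ := v.exists_rotate_eq hE hr hcw (by simp [heq]) (hCeq ▸ hC.1)
    exact ⟨e, he, hCeq.symm⟩
  · rintro ⟨e, he, rfl⟩
    obtain ⟨w, hw⟩ := v.exists_phi_eq_rotate hE he
    refine ⟨hw ▸ CliqueVec.isMaxClique_phi hE w, _, v.removedRoute_mem_phi hE he, _,
      Set.mem_insert _ _, v.clockwise_removedRoute_addedRoute hE he, ?_⟩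
    rw [CliqueVec.rotate, Set.insert_sdiff_self_of_notMem]
    exact fun h => v.addedRoute_notMem_phi hE he h.1
end
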